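/- Let A be a monotone allocation region, n ≥ 1 an integer, and ε = 1/n. Then the ε-approximation φ_ε(A) is a closed monotone allocation region contained in A. -/

import Mathlib

open MeasureTheory Set
open scoped Classical

noncomputable section

/-- The unit square `[0,1]²` of valuation pairs. -/
def square : Set (ℝ × ℝ) := Set.Icc (0:ℝ) 1 ×ˢ Set.Icc (0:ℝ) 1

/-- A (bilateral-trade) monotone allocation region: a closed subset of the unit square,
closed in the north-west direction. -/
def IsAllocRegion (A : Set (ℝ × ℝ)) : Prop :=
  IsClosed A ∧ A ⊆ square ∧
    ∀ x ∈ A, ∀ y ∈ square, y.1 ≤ x.1 → x.2 ≤ y.2 → y ∈ A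

/-- Myerson seller payment `p_A`. -/
def sellerPay (A : Set (ℝ × ℝ)) (v : ℝ × ℝ) : ℝ :=
  if v ∈ A then sSup {x : ℝ | x ∈ Set.Icc (0:ℝ) 1 ∧ (x, v.2) ∈ A} else 0

/-- Myerson buyer payment `q_A`. -/
def buyerPay (A : Set (ℝ × ℝ)) (v : ℝ × ℝ) : ℝ :=
  if v ∈ A then sInf {y : ℝ | y ∈ Set.Icc (0:ℝ) 1 ∧ (v.1, y) ∈ A} else 0

/-- The broker's profit. -/
def profit (A : Set (ℝ × ℝ)) (v : ℝ × ℝ) : ℝ :=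
  buyerPay A v - sellerPay A v

/-- The closed `ε`-tile with lower-left corner `(k/n, j/n)`, where `ε = 1/n`. -/
def tile (n k j : ℕ) : Set (ℝ × ℝ) :=
  Set.Icc ((k : ℝ) / n) (((k : ℝ) + 1) / n) ×ˢ Set.Icc ((j : ℝ) / n) (((j : ℝ) + 1) / n)

/-- The `ε`-approximation `φ_ε(A)`: the union of all `ε`-tiles contained in `A`. -/
def gridApprox (n : ℕ) (A : Set (ℝ × ℝ)) : Set (ℝ × ℝ) :=
  ⋃ (k : Fin n) (j : Fin n) (_ : tile n k j ⊆ A), tile n k j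

end

/-- A point of `[a/n, (b+1)/n]` lies in one of the grid cells `[m/n, (m+1)/n]` with `a ≤ m ≤ b`. -/
theorem exists_mem_Icc_grid {n : ℕ} (hn : 0 < n) {a b : ℕ} (hab : a ≤ b) {t : ℝ}
    (ht : t ∈ Set.Icc ((a : ℝ) / n) (((b : ℝ) + 1) / n)) :
    ∃ m : ℕ, a ≤ m ∧ m ≤ b ∧ t ∈ Set.Icc ((m : ℝ) / n) (((m : ℝ) + 1) / n) := by
  have hn' : (0 : ℝ) < n := Nat.cast_pos.mpr hn
  obtain ⟨hat, htb⟩ := ht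
  rw [div_le_iff₀ hn'] at hat
  rw [le_div_iff₀ hn'] at htb
  have h0 : 0 ≤ t * n := (Nat.cast_nonneg a).trans hat
  refine ⟨min b ⌊t * n⌋₊, le_min hab (Nat.le_floor hat), min_le_left _ _, ?_, ?_⟩
  · rw [div_le_iff₀ hn']
    exact (Nat.cast_le.mpr (min_le_right _ _)).trans (Nat.floor_le h0)
  · rw [le_div_iff₀ hn']
    rcases min_choice b ⌊t * n⌋₊ with h | h <;> rw [h]
    · exact htb
    · exact (Nat.lt_floor_add_one _).le

theorem isClosed_tile (n k j : ℕ) : IsClosed (tile n k j) :=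
  isClosed_Icc.prod isClosed_Icc

theorem tile_subset_square {n k j : ℕ} (hk : k < n) (hj : j < n) : tile n k j ⊆ square := by
  have hn : (0 : ℝ) < n := Nat.cast_pos.mpr (by omega)
  have cell {m : ℕ} (hm : m < n) :
      Set.Icc ((m : ℝ) / n) (((m : ℝ) + 1) / n) ⊆ Set.Icc 0 1 :=
    Set.Icc_subset_Icc (by positivity) ((div_le_one hn).mpr (by exact_mod_cast hm))
  exact Set.prod_mono (cell hk) (cell hj)

/-- If a monotone region contains a tile, it contains every tile to the north-west of it. -/
theorem IsAllocRegion.tile_subset {A : Set (ℝ × ℝ)} (hA : IsAllocRegion A) {n k j k' j' : ℕ}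
    (h : tile n k j ⊆ A) (hk : k' ≤ k) (hj : j ≤ j') (hkn : k' < n) (hjn : j' < n) :
    tile n k' j' ⊆ A := by
  intro z hz
  have corner : (((k : ℝ) + 1) / n, (j : ℝ) / n) ∈ tile n k j :=
    ⟨⟨by dsimp only; gcongr; linarith, le_rfl⟩, ⟨le_rfl, by dsimp only; gcongr; linarith⟩⟩
  refine hA.2.2 _ (h corner) z (tile_subset_square hkn hjn hz) (hz.1.2.trans ?_)
    (le_trans ?_ hz.2.1) <;> dsimp only <;> gcongr

theorem mem_gridApprox {n : ℕ} {A : Set (ℝ × ℝ)} {x : ℝ × ℝ} :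
    x ∈ gridApprox n A ↔ ∃ k j : Fin n, tile n k j ⊆ A ∧ x ∈ tile n k j := by
  simp only [gridApprox, Set.mem_iUnion, exists_prop]

theorem gridApprox_subset (n : ℕ) (A : Set (ℝ × ℝ)) : gridApprox n A ⊆ A := by
  intro x hx
  obtain ⟨k, j, h, hx⟩ := mem_gridApprox.mp hx
  exact h hx

theorem isClosed_gridApprox (n : ℕ) (A : Set (ℝ × ℝ)) : IsClosed (gridApprox n A) :=
  isClosed_iUnion_of_finite fun _ => isClosed_iUnion_of_finite fun _ =>
    isClosed_iUnion_of_finite fun _ => isClosed_tile _ _ _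

/-- the ε-approximation of a monotone allocation region is a closed
monotone allocation region contained in the original region. -/
theorem gridApprox_isAllocRegion (A : Set (ℝ × ℝ)) (hA : IsAllocRegion A)
    (n : ℕ) (hn : 1 ≤ n) :
    IsClosed (gridApprox n A) ∧ IsAllocRegion (gridApprox n A) ∧ gridApprox n A ⊆ A := by
  refine ⟨isClosed_gridApprox n A, ⟨isClosed_gridApprox n A,
    (gridApprox_subset n A).trans hA.2.1, ?_⟩, gridApprox_subset n A⟩
  intro x hx y hy h1 h2
  obtain ⟨k, j, h, hx⟩ := mem_gridApprox.mp hx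
  have hn' : (0 : ℝ) < n := Nat.cast_pos.mpr hn
  obtain ⟨k', -, hk, hyk⟩ := exists_mem_Icc_grid (t := y.1) hn (Nat.zero_le (k : ℕ))
    ⟨by simpa using hy.1.1, h1.trans hx.1.2⟩
  have hjn : (j : ℕ) ≤ n - 1 := by omega
  obtain ⟨j', hj, hj', hyj⟩ := exists_mem_Icc_grid (t := y.2) hn hjn
    ⟨hx.2.1.trans h2, by
      rw [Nat.cast_sub hn, Nat.cast_one, sub_add_cancel, div_self hn'.ne']
      exact hy.2.2⟩
  have hkn : k' < n := hk.trans_lt k.isLt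
  have hjn' : j' < n := by omega
  exact mem_gridApprox.mpr ⟨⟨k', hkn⟩, ⟨j', hjn'⟩, hA.tile_subset h hk hj hkn hjn', hyk, hyj⟩
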